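/- arXiv:1402.0980 — 4 statements merged into one kernel-verified Lean document; each statement's English description precedes it below -/
import Mathlib

section
/- Suppose σ is surjective and A is ∂-simple. If I is a nonzero ideal of the σ-deformed Witt algebra (A, [·,·], σ), i.e., a nonzero F-subspace of A with [a,x] ∈ I for all a ∈ A and x ∈ I, then the image of ∂ is contained in I: ∂(A) ⊆ I. -/
section SigmaDerivation

variable {F A : Type*} [Field F] [CommRing A] [Algebra F A]
  {σ : A →ₐ[F] A} {g : A} {D : A → A}

theorem mul_sigmaBracket (hD : ∀ x : A, g * D x = x - σ x) (a x : A) :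
    g * (σ a * D x - σ x * D a) = σ a * x - a * σ x := by
  linear_combination σ a * hD x - σ x * hD a

theorem sigma_apply_gcd_ne_zero (hσ : σ ≠ AlgHom.id F A) (hsurj : Function.Surjective σ)
    (hD : ∀ x : A, g * D x = x - σ x) : σ g ≠ 0 := by
  intro h
  apply hσ
  ext y
  obtain ⟨x, rfl⟩ := hsurj y
  have h1 := congrArg σ (hD x)
  rw [map_mul, h, zero_mul, map_sub] at h1
  exact (sub_eq_zero.mp h1.symm).symm

variable [IsDomain A]

theorem sigmaDerivation_add (hg0 : g ≠ 0) (hD : ∀ x : A, g * D x = x - σ x) (x y : A) :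
    D (x + y) = D x + D y := by
  apply mul_left_cancel₀ hg0
  rw [mul_add, hD, hD, hD, map_add]
  ring

theorem sigmaDerivation_mul (hg0 : g ≠ 0) (hD : ∀ x : A, g * D x = x - σ x) (x y : A) :
    D (x * y) = D x * y + σ x * D y := by
  apply mul_left_cancel₀ hg0
  rw [hD, map_mul]
  linear_combination (-y) * hD x - σ x * hD y

/-- A nontrivial surjective `σ` is injective when `A` is `D`-simple. -/
theorem sigma_injective_of_simple (hσ : σ ≠ AlgHom.id F A) (hsurj : Function.Surjective σ)
    (hD : ∀ x : A, g * D x = x - σ x)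
    (hsimple : ∀ I : Ideal A, (∀ x ∈ I, D x ∈ I) → I = ⊥ ∨ I = ⊤) :
    Function.Injective σ := by
  have hσg := sigma_apply_gcd_ne_zero hσ hsurj hD
  rcases hsimple (RingHom.ker σ) (fun x hx => by
    rw [RingHom.mem_ker] at hx ⊢
    have h1 := congrArg σ (hD x)
    rw [hx, sub_zero, map_mul, hx] at h1
    exact (mul_eq_zero.mp h1).resolve_left hσg) with h | h
  · exact (RingHom.injective_iff_ker_eq_bot σ).mpr h
  · exact absurd h (RingHom.ker_ne_top σ)

variable {I : Submodule F A}

theorem sigmaDerivation_mem (hg0 : g ≠ 0) (hD : ∀ x : A, g * D x = x - σ x)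
    (hIbr : ∀ a : A, ∀ x ∈ I, σ a * D x - σ x * D a ∈ I) {x : A} (hx : x ∈ I) : D x ∈ I := by
  have hD1 : D 1 = 0 := mul_left_cancel₀ hg0 (by rw [hD, map_one, sub_self, mul_zero])
  simpa [hD1] using hIbr 1 x hx

/-- The set of `y` with `D (A y) ⊆ I` is a `D`-stable ideal, so it is everything once it is
nonzero. -/
theorem sigmaDerivation_mem_of_ideal (hg0 : g ≠ 0) (hsurj : Function.Surjective σ)
    (hD : ∀ x : A, g * D x = x - σ x)
    (hsimple : ∀ I : Ideal A, (∀ x ∈ I, D x ∈ I) → I = ⊥ ∨ I = ⊤)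
    (hDI : ∀ x ∈ I, D x ∈ I) {y : A} (hy0 : y ≠ 0) (hy : ∀ a, D (a * y) ∈ I) (a : A) :
    D a ∈ I := by
  let J : Ideal A :=
    { carrier := {y | ∀ a, D (a * y) ∈ I}
      add_mem' := fun {p q} hp hq a => by
        rw [mul_add, sigmaDerivation_add hg0 hD]
        exact I.add_mem (hp a) (hq a)
      zero_mem' := fun a => by
        have h0 : D 0 = 0 := mul_left_cancel₀ hg0 (by rw [hD, map_zero, sub_self, mul_zero])
        simp [h0]
      smul_mem' := fun c p hp a => by
        rw [smul_eq_mul, ← mul_assoc]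
        exact hp _ }
  rcases hsimple J (fun p hp b => by
    obtain ⟨c, rfl⟩ := hsurj b
    have h1 := hDI _ (hp c)
    rw [sigmaDerivation_mul hg0 hD, sigmaDerivation_add hg0 hD] at h1
    exact (I.add_mem_iff_right (hp (D c))).mp h1) with h | h
  · have hyJ : y ∈ J := hy
    rw [h, Ideal.mem_bot] at hyJ
    exact absurd hyJ hy0
  · have h1 : (1 : A) ∈ J := h ▸ Submodule.mem_top
    simpa using h1 a

/-- If `σ` is not an involution, a nonzero bracket ideal contains a nonzero ring ideal. -/
theorem exists_ne_zero_forall_mul_mem (hg0 : g ≠ 0) (hσ : σ ≠ AlgHom.id F A)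
    (hsurj : Function.Surjective σ) (hinj : Function.Injective σ)
    (hD : ∀ x : A, g * D x = x - σ x)
    (hIbr : ∀ a : A, ∀ x ∈ I, σ a * D x - σ x * D a ∈ I) {x : A} (hx : x ∈ I) (hx0 : x ≠ 0)
    {t : A} (ht : σ (σ t) ≠ t) : ∃ y : A, y ≠ 0 ∧ ∀ a, a * y ∈ I := by
  obtain ⟨s, hs⟩ : ∃ s, σ s ≠ s := by
    by_contra! h
    exact hσ (AlgHom.ext h)
  have hσg := sigma_apply_gcd_ne_zero hσ hsurj hD
  let B : A → A → A := fun a y => σ a * D y - σ y * D a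
  have hB (a b : A) : g * (g * (σ g * B a (B b x))) =
      σ g * σ a * (σ b * x - b * σ x) - g * a * (σ (σ b) * σ x - σ b * σ (σ x)) := by
    have h1 : g * B a (B b x) = σ a * B b x - a * σ (B b x) := mul_sigmaBracket hD a (B b x)
    have h2 : g * B b x = σ b * x - b * σ x := mul_sigmaBracket hD b x
    have h3 : σ g * σ (B b x) = σ (σ b) * σ x - σ b * σ (σ x) := by
      simpa using congrArg σ h2
    linear_combination g * σ g * h1 + σ g * σ a * h2 - g * a * h3
  let N : A → A → A := fun α β =>
    B α (B (β * σ s * t) x) - B (σ (σ t) * α) (B (σ s * β) x)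
      - B (s * α) (B (t * β) x) + B (s * σ (σ t) * α) (B β x)
  have hNI (α β : A) : N α β ∈ I := by
    have h (a b : A) : B a (B b x) ∈ I := hIbr a _ (hIbr b x hx)
    exact I.add_mem (I.sub_mem (I.sub_mem (h _ _) (h _ _)) (h _ _)) (h _ _)
  have hN (α β : A) : g * (g * (σ g * N α β)) = σ β *
      (x * σ g * σ α * ((σ (σ s) - σ s) * (σ t - σ (σ (σ t))))
        + g * σ (σ x) * α * ((σ (σ s) - s) * (σ t - σ (σ t)))) := by
    have h1 := hB α (β * σ s * t)
    have h2 := hB (σ (σ t) * α) (σ s * β)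
    have h3 := hB (s * α) (t * β)
    have h4 := hB (s * σ (σ t) * α) β
    simp only [map_mul] at h1 h2 h3 h4
    linear_combination h1 - h2 - h3 + h4
  have hNmul (α β : A) : N α β = σ β * N α 1 := by
    apply mul_left_cancel₀ hg0
    apply mul_left_cancel₀ hg0
    apply mul_left_cancel₀ hσg
    have h1 := hN α β
    have h2 := hN α 1
    rw [map_one, one_mul] at h2
    linear_combination h1 - σ β * h2
  have hex : ∃ α, N α 1 ≠ 0 := by
    by_contra! h
    have h1 := hN 1 1
    have h2 := hN s 1
    rw [h] at h1 h2
    simp only [map_one, one_mul, mul_one, mul_zero] at h1 h2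
    have h3 : x * σ g * ((σ (σ s) - σ s) * (σ t - σ (σ (σ t)))) * (σ s - s) = 0 := by
      linear_combination s * h1 - h2
    simp only [mul_eq_zero, sub_eq_zero, hx0, hσg, hs, hinj.eq_iff, or_false, false_or] at h3
    exact ht h3.symm
  obtain ⟨α, hα⟩ := hex
  refine ⟨N α 1, hα, fun a => ?_⟩
  obtain ⟨β, rfl⟩ := hsurj a
  rw [← hNmul]
  exact hNI α β

end SigmaDerivation


/-- Suppose `σ` is surjective and `A` is `D`-simple.  If `I`
is a nonzero ideal of the `σ`-deformed Witt algebra `(A, [·,·], σ)` then the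
image of `D` is contained in `I`. -/
theorem image_of_partial_subset_ideal
    {F A : Type*} [Field F] [CommRing A] [IsDomain A]
    [UniqueFactorizationMonoid A] [Algebra F A]
    (σ : A →ₐ[F] A) (hσ : σ ≠ AlgHom.id F A) (hsurj : Function.Surjective σ)
    (g : A) (hg0 : g ≠ 0)
    (hgdvd : ∀ x : A, g ∣ x - σ x)
    (hggcd : ∀ h : A, (∀ x : A, h ∣ x - σ x) → h ∣ g)
    (D : A → A) (hD : ∀ x : A, g * D x = x - σ x)
    (hsimple : ∀ I : Ideal A, (∀ x ∈ I, D x ∈ I) → I = ⊥ ∨ I = ⊤)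
    (I : Submodule F A) (hI0 : I ≠ ⊥)
    (hIbr : ∀ a : A, ∀ x ∈ I, σ a * D x - σ x * D a ∈ I) :
    ∀ a : A, D a ∈ I := by
  obtain ⟨x, hx, hx0⟩ := I.ne_bot_iff.mp hI0
  have hDI : ∀ y ∈ I, D y ∈ I := fun y hy => sigmaDerivation_mem hg0 hD hIbr hy
  have hinj := sigma_injective_of_simple hσ hsurj hD hsimple
  by_cases hinv : ∀ t, σ (σ t) = t
  · refine sigmaDerivation_mem_of_ideal hg0 hsurj hD hsimple hDI
      (mul_ne_zero hx0 ((map_ne_zero_iff σ hinj).mpr hx0)) fun a => ?_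
    have h1 : D (a * (x * σ x)) = -(σ (a * x) * D x - σ x * D (a * x)) := by
      apply mul_left_cancel₀ hg0
      rw [mul_neg, mul_sigmaBracket hD, hD]
      simp only [map_mul, hinv]
      ring
    rw [h1]
    exact I.neg_mem (hIbr _ _ hx)
  · push Not at hinv
    obtain ⟨t, ht⟩ := hinv
    obtain ⟨y, hy0, hy⟩ := exists_ne_zero_forall_mul_mem hg0 hσ hsurj hinj hD hIbr hx hx0 ht
    exact sigmaDerivation_mem_of_ideal hg0 hsurj hD hsimple hDI hy0 fun a => hDI _ (hy a)
end

section
/- Suppose σ is surjective, ∂(A) = A, and δ is a scalar, i.e., δ = c·1 for some c ∈ F. Let σ₁ : A → A be given by σ₁(a) = σ(a) + c·a. Then the Hom-Lie algebra (A, [·,·], σ₁) is simple (the only F-subspaces I of A with [a,x] ∈ I for all a ∈ A, x ∈ I are {0} and A) if and only if A is ∂-simple. -/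
/-- A map `D` with `g * D x = x - σ x` is a `σ`-twisted derivation. -/
theorem twisted_leibniz_of_mul_eq_sub {A : Type*} [CommRing A] [IsDomain A]
    {σ : A →+* A} {g : A} (hg0 : g ≠ 0) {D : A → A} (hD : ∀ x, g * D x = x - σ x) (a b : A) :
    D (a * b) = D a * b + σ a * D b := by
  apply mul_left_cancel₀ hg0
  linear_combination hD (a * b) - b * hD a - σ a * hD b - map_mul σ a b

/-- A surjective endomorphism `σ ≠ id` is injective when `A` has no nontrivial ideal stable under
the map `D = (id - σ) / g`. -/
theorem injective_of_stable_ideals_trivial {A : Type*} [CommRing A] [IsDomain A]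
    {σ : A →+* A} (hσ : σ ≠ RingHom.id A) (hsurj : Function.Surjective σ)
    {g : A} {D : A → A} (hD : ∀ x, g * D x = x - σ x)
    (hsimple : ∀ I : Ideal A, (∀ x ∈ I, D x ∈ I) → I = ⊥ ∨ I = ⊤) :
    Function.Injective σ := by
  have hσg : σ g ≠ 0 := by
    intro h0
    refine hσ (RingHom.ext fun y => ?_)
    obtain ⟨x, rfl⟩ := hsurj y
    have h := congrArg σ (hD x)
    rw [map_mul, h0, zero_mul, map_sub] at h
    exact (sub_eq_zero.mp h.symm).symm
  rw [RingHom.injective_iff_ker_eq_bot]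
  refine (hsimple (RingHom.ker σ) fun x hx => ?_).resolve_right (RingHom.ker_ne_top σ)
  rw [RingHom.mem_ker] at hx ⊢
  have h := congrArg σ (hD x)
  rw [map_mul, map_sub, hx, map_zero, sub_zero] at h
  exact (mul_eq_zero.mp h).resolve_left hσg

/-- The largest ideal contained in a subspace of a commutative algebra. -/
def Submodule.idealCore {F A : Type*} [CommSemiring F] [CommSemiring A] [Algebra F A]
    (I : Submodule F A) : Ideal A where
  carrier := {x | ∀ a : A, a * x ∈ I}
  add_mem' hx hy a := by rw [mul_add]; exact I.add_mem (hx a) (hy a)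
  zero_mem' a := by rw [mul_zero]; exact I.zero_mem
  smul_mem' b x hx a := by rw [smul_eq_mul, ← mul_assoc]; exact hx (a * b)

theorem Submodule.mem_idealCore {F A : Type*} [CommSemiring F] [CommSemiring A] [Algebra F A]
    {I : Submodule F A} {x : A} : x ∈ I.idealCore ↔ ∀ a : A, a * x ∈ I :=
  Iff.rfl


/-- Suppose `σ` is surjective, `D(A) = A`, and `δ = c • 1` is
a scalar.  With `σ₁ a = σ a + c • a`, the Hom-Lie algebra `(A, [·,·], σ₁)` with
bracket `[a,b] = σ a * D b - σ b * D a` is simple iff `A` is `D`-simple. -/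
theorem Hom_Lie_simple_iff_partial_simple
    {F A : Type*} [Field F] [CommRing A] [IsDomain A]
    [UniqueFactorizationMonoid A] [Algebra F A]
    (σ : A →ₐ[F] A) (hσ : σ ≠ AlgHom.id F A) (hsurj : Function.Surjective σ)
    (g : A) (hg0 : g ≠ 0)
    (hgdvd : ∀ x : A, g ∣ x - σ x)
    (hggcd : ∀ h : A, (∀ x : A, h ∣ x - σ x) → h ∣ g)
    (D : A → A) (hD : ∀ x : A, g * D x = x - σ x)
    (hDsurj : Function.Surjective D)
    (δ : A) (hδ : g * δ = σ g)
    (c : F) (hδc : δ = algebraMap F A c)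
    (σ₁ : A → A) (hσ₁ : ∀ a : A, σ₁ a = σ a + c • a) :
    (∀ I : Submodule F A,
        (∀ a : A, ∀ x ∈ I, σ a * D x - σ x * D a ∈ I) → I = ⊥ ∨ I = ⊤)
    ↔ (∀ I : Ideal A, (∀ x ∈ I, D x ∈ I) → I = ⊥ ∨ I = ⊤) := by
  have hD' : ∀ x, g * D x = x - (σ : A →+* A) x := hD
  have leibniz (a b : A) : D (a * b) = D a * b + σ a * D b :=
    twisted_leibniz_of_mul_eq_sub hg0 hD' a b
  constructor
  · intro hLie I hI
    have hσI (x : A) (hx : x ∈ I) : σ x ∈ I := by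
      rw [show σ x = x - g * D x by linear_combination hD x]
      exact I.sub_mem hx (I.mul_mem_left g (hI x hx))
    refine (hLie (I.restrictScalars F) fun a x hx =>
      I.sub_mem (I.mul_mem_left _ (hI x hx)) (I.mul_mem_right _ (hσI x hx))).imp ?_ ?_
    · exact (Submodule.restrictScalars_eq_bot_iff F A A).mp
    · exact (Submodule.restrictScalars_eq_top_iff F A A).mp
  · intro hsimple I hI
    have hinj : Function.Injective σ :=
      injective_of_stable_ideals_trivial (σ := (σ : A →+* A))
        (fun h => hσ (AlgHom.ext fun x => DFunLike.congr_fun h x)) hsurj hD' hsimple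
    have hD1 : D 1 = 0 := by
      apply mul_left_cancel₀ hg0
      rw [hD, map_one, sub_self, mul_zero]
    have hDI (x : A) (hx : x ∈ I) : D x ∈ I := by
      simpa [hD1] using hI 1 x hx
    have hcore : ∀ x ∈ I.idealCore, D x ∈ I.idealCore := by
      intro x hx b
      obtain ⟨a, rfl⟩ := hsurj b
      rw [show σ a * D x = D (a * x) - D a * x by rw [leibniz]; ring]
      exact I.sub_mem (hDI _ (hx a)) (hx (D a))
    rcases hsimple I.idealCore hcore with h | h
    · left
      rw [Submodule.eq_bot_iff]
      intro x hx
      have hmem : x * σ x ∈ I.idealCore := by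
        intro b
        obtain ⟨a, rfl⟩ := hDsurj b
        have key : σ (x * a) * D x - σ x * D (x * a) = -(D a * (x * σ x)) := by
          apply mul_left_cancel₀ hg0
          linear_combination σ (x * a) * hD x - σ x * hD (x * a) + x * σ x * hD a
            + x * map_mul σ x a
        rw [← neg_neg (D a * (x * σ x)), ← key]
        exact I.neg_mem (hI _ x hx)
      rw [h, Ideal.mem_bot, mul_eq_zero, map_eq_zero_iff σ hinj, or_self] at hmem
      exact hmem
    · right
      rw [Submodule.eq_top_iff']
      intro x
      have h1 : (1 : A) ∈ I.idealCore := h ▸ Submodule.mem_top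
      simpa using Submodule.mem_idealCore.mp h1 x
end

section
/- Let q ∈ ℂ be nonzero and not a root of unity, and let ∂ : ℂ[t] → ℂ[t] be the map determined by (1−q)·t·∂(f) = f(t) − f(qt). Then ℂ[t] is ∂-simple: every nonzero ideal I of ℂ[t] with ∂(I) ⊆ I equals ℂ[t]. -/
open Polynomial

/-- The `q`-difference quotient acts on coefficients by
`(1 - q) * [t ^ n] D f = (1 - q ^ (n + 1)) * [t ^ (n + 1)] f`. -/
theorem coeff_of_qDifference {R : Type*} [CommRing R] {q : R} {f g : R[X]}
    (h : (1 - C q) * X * g = f - f.comp (C q * X)) (n : ℕ) :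
    (1 - q) * g.coeff n = (1 - q ^ (n + 1)) * f.coeff (n + 1) := by
  have h' := congrArg (fun p : R[X] => p.coeff (n + 1)) h
  have hg : (1 - C q) * X * g = C (1 - q) * (g * X) := by
    rw [C_sub, C_1]; ring
  simp only [hg, coeff_C_mul, coeff_mul_X, coeff_sub, comp_C_mul_X_coeff] at h'
  rw [h']; ring

/-- For `q` not a root of unity, the `q`-difference quotient lowers a positive degree by one. -/
theorem natDegree_of_qDifference {R : Type*} [CommRing R] [IsDomain R] {q : R}
    (hq : ∀ n : ℕ, 0 < n → q ^ n ≠ 1) {f g : R[X]}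
    (h : (1 - C q) * X * g = f - f.comp (C q * X)) {n : ℕ} (hf : f.natDegree = n + 1) :
    g ≠ 0 ∧ g.natDegree = n := by
  have hq1 : 1 - q ≠ 0 := sub_ne_zero.mpr fun e => hq 1 one_pos (by simp [← e])
  have hn : g.coeff n ≠ 0 := by
    refine right_ne_zero_of_mul (a := 1 - q) ?_
    rw [coeff_of_qDifference h]
    refine mul_ne_zero (sub_ne_zero.mpr (hq _ n.succ_pos).symm) ?_
    rw [← hf, coeff_natDegree, leadingCoeff_ne_zero]
    rintro rfl
    simp at hf
  refine ⟨fun e => hn (by simp [e]), natDegree_eq_of_le_of_coeff_ne_zero ?_ hn⟩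
  refine natDegree_le_iff_coeff_eq_zero.mpr fun m hm => ?_
  refine (mul_eq_zero.mp ?_).resolve_left hq1
  rw [coeff_of_qDifference h, coeff_eq_zero_of_natDegree_lt (by omega), mul_zero]

/-- For `q ∈ ℂ` nonzero and not a root of unity, `ℂ[t]` is
`D`-simple, where `(1-q)·t·D f = f(t) - f(qt)`: every nonzero `D`-stable ideal
of `ℂ[t]` is the whole ring. -/
theorem polynomial_ring_partial_simple
    (q : ℂ) (hq0 : q ≠ 0) (hq : ∀ n : ℕ, 0 < n → q ^ n ≠ 1)
    (D : ℂ[X] → ℂ[X])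
    (hD : ∀ f : ℂ[X], (1 - C q) * X * D f = f - f.comp (C q * X)) :
    ∀ I : Ideal ℂ[X], I ≠ ⊥ → (∀ x ∈ I, D x ∈ I) → I = ⊤ := by
  intro I hI hDI
  obtain ⟨f, hfI, hf0⟩ := Submodule.exists_mem_ne_zero_of_ne_bot hI
  induction hn : f.natDegree generalizing f with
  | zero =>
    refine Ideal.eq_top_of_isUnit_mem I hfI (isUnit_iff_degree_eq_zero.mpr ?_)
    rw [degree_eq_natDegree hf0, hn, Nat.cast_zero]
  | succ n ih =>
    obtain ⟨hg0, hgn⟩ := natDegree_of_qDifference hq (hD f) hn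
    exact ih (D f) (hDI f hfI) hg0 hgn
end

section
/- Let q ∈ ℂ be nonzero and not a root of unity, and σ the ℂ-algebra endomorphism of the Laurent polynomial ring ℂ[t,t⁻¹] with σ(t) = q·t. Then every nonzero ideal I of ℂ[t,t⁻¹] with σ(I) ⊆ I equals the whole ring ℂ[t,t⁻¹]. -/
open LaurentPolynomial

theorem zpow_injective_of_pow_ne_one {K : Type*} [DivisionRing K] {q : K} (hq0 : q ≠ 0)
    (hq : ∀ n : ℕ, 0 < n → q ^ n ≠ 1) : Function.Injective fun k : ℤ => q ^ k := by
  have key : ∀ i j : ℤ, i < j → q ^ i ≠ q ^ j := by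
    intro i j hij h
    refine hq (j - i).toNat (by omega) ?_
    rw [← zpow_natCast, Int.toNat_of_nonneg (by omega), zpow_sub₀ hq0, ← h,
      div_self (zpow_ne_zero i hq0)]
  intro i j h
  rcases lt_trichotomy i j with hij | hij | hij
  · exact (key i j hij h).elim
  · exact hij
  · exact (key j i hij h.symm).elim

theorem LaurentPolynomial.coeff_of_map_T {R : Type*} [CommSemiring R] {c : ℤ → R}
    {σ : R[T;T⁻¹] →ₐ[R] R[T;T⁻¹]} (hσ : ∀ k : ℤ, σ (T k) = C (c k) * T k)
    (f : R[T;T⁻¹]) (j : ℤ) : (σ f).coeff j = c j * f.coeff j := by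
  induction f using LaurentPolynomial.induction_on' with
  | add f g hf hg => simp [hf, hg, mul_add]
  | C_mul_T n a =>
    rw [← smul_eq_C_mul, map_smul, hσ, ← smul_eq_C_mul]
    by_cases h : n = j <;> simp [h, mul_comm]

/-- For `q ∈ ℂ` nonzero and not a root of unity and `σ` the
`ℂ`-algebra endomorphism of `ℂ[t,t⁻¹]` with `σ(tᵏ) = qᵏ tᵏ`, every nonzero
`σ`-stable ideal of `ℂ[t,t⁻¹]` is the whole ring. -/
theorem Laurent_polynomials_sigma_simple
    (q : ℂ) (hq0 : q ≠ 0) (hq : ∀ n : ℕ, 0 < n → q ^ n ≠ 1)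
    (σ : ℂ[T;T⁻¹] →ₐ[ℂ] ℂ[T;T⁻¹])
    (hσ : ∀ k : ℤ, σ (T k) = C (q ^ k) * T k) :
    ∀ I : Ideal ℂ[T;T⁻¹], I ≠ ⊥ → (∀ x ∈ I, σ x ∈ I) → I = ⊤ := by
  intro I hI hσI
  obtain ⟨f, hfI, hf0⟩ := Submodule.exists_mem_ne_zero_of_ne_bot hI
  induction hn : f.coeff.support.card using Nat.strong_induction_on generalizing f with
  | _ n ih =>
    obtain ⟨k, hk⟩ : ∃ k, f.coeff k ≠ 0 := by
      by_contra! h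
      exact hf0 (LaurentPolynomial.ext fun a => by simp [h a])
    have hcoeff : ∀ j, (σ f - q ^ k • f).coeff j = (q ^ j - q ^ k) * f.coeff j := by
      intro j
      simp [coeff_of_map_T hσ, sub_mul]
    have hgI : σ f - q ^ k • f ∈ I := by
      rw [smul_eq_C_mul]
      exact I.sub_mem (hσI f hfI) (I.mul_mem_left _ hfI)
    by_cases hg : σ f - q ^ k • f = 0
    · have hf : f = C (f.coeff k) * T k := by
        refine LaurentPolynomial.ext fun j => ?_
        rw [← smul_eq_C_mul]
        by_cases hjk : k = j
        · simp [hjk]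
        · have h := hcoeff j
          rw [hg] at h
          have hne : q ^ j - q ^ k ≠ 0 :=
            sub_ne_zero.2 fun e => hjk (zpow_injective_of_pow_ne_one hq0 hq e).symm
          have hj : f.coeff j = 0 := by simpa [hne] using h
          simp [hjk, hj]
      refine I.eq_top_of_isUnit_mem hfI ?_
      rw [hf]
      exact ((isUnit_iff_ne_zero.2 hk).map C).mul (isUnit_T k)
    · refine ih _ ?_ _ hgI hg rfl
      rw [← hn]
      refine Finset.card_lt_card (Finset.ssubset_iff_subset_ne.2 ⟨fun j hj => ?_, fun h => ?_⟩)
      · rw [Finsupp.mem_support_iff, hcoeff] at hj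
        exact Finsupp.mem_support_iff.2 (right_ne_zero_of_mul hj)
      · have hk' := Finsupp.mem_support_iff.2 hk
        rw [← h, Finsupp.mem_support_iff, hcoeff] at hk'
        simp at hk'
end
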